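/- (Global energy and momentum conservation for the coupled nonlinear Schrödinger equations under periodic boundary conditions) Let α, β ∈ ℝ, L > 0, x₀ ∈ ℝ, and let u, v : ℝ × ℝ → ℂ be twice continuously differentiable solutions of i u_t + i α u_x + (1/2) u_xx + (|u|² + β|v|²) u = 0 and i v_t − i α v_x + (1/2) v_xx + (β|u|² + |v|²) v = 0 that are L-periodic in x (u(x+L,t) = u(x,t) and v(x+L,t) = v(x,t) for all x, t). Write u = q₁ + i q₂, v = q₃ + i q₄ with q₁, q₂, q₃, q₄ real, p_i = (1/2) ∂_x q_i, S = −(1/4)(q₁²+q₂²)² − (1/4)(q₃²+q₄²)² − (1/2) β (q₁²+q₂²)(q₃²+q₄²) − (p₁²+p₂²+p₃²+p₄²), E = S − α(q₂p₁ − q₁p₂ + q₃p₄ − q₄p₃) − (1/2) Σ_{i=1}^4 (q_i ∂_x p_i − 2 p_i²), and I = q₂p₁ − q₁p₂ + q₄p₃ − q₃p₄. Then for every t, ∫_{x₀}^{x₀+L} E(x,t) dx = ∫_{x₀}^{x₀+L} E(x,0) dx and ∫_{x₀}^{x₀+L} I(x,t) dx = ∫_{x₀}^{x₀+L} I(x,0)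 dx. -/

import Mathlib

open scoped Matrix

open intervalIntegral MeasureTheory in
/-- If a density `w` and a flux `f` satisfy `∂ₜ w = ∂ₓ f`, and the flux takes equal values at the
endpoints `a` and `b`, then the integral of `w` over `[a, b]` does not depend on time. -/
theorem integral_eq_of_conservation_law {w w' f : ℝ → ℝ → ℝ} {a b : ℝ}
    (hw' : Continuous fun p : ℝ × ℝ => w' p.1 p.2)
    (hw : ∀ x t, HasDerivAt (fun τ => w x τ) (w' x t) t)
    (hf : ∀ x t, HasDerivAt (fun ξ => f ξ t) (w' x t) x)
    (hab : ∀ t, f b t = f a t) (hwc : ∀ t, Continuous fun x => w x t) (s t : ℝ) :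
    ∫ x in a..b, w x t = ∫ x in a..b, w x s := by
  rw [← sub_eq_zero, ← integral_sub ((hwc t).intervalIntegrable _ _)
    ((hwc s).intervalIntegrable _ _)]
  have hx (x : ℝ) : w x t - w x s = ∫ τ in s..t, w' x τ :=
    (integral_eq_sub_of_hasDerivAt (fun τ _ => hw x τ)
      ((hw'.comp (by fun_prop : Continuous fun τ : ℝ => (x, τ))).intervalIntegrable _ _)).symm
  have ht (τ : ℝ) : ∫ x in a..b, w' x τ = 0 := by
    rw [integral_eq_sub_of_hasDerivAt (fun x _ => hf x τ)
      ((hw'.comp (by fun_prop : Continuous fun x : ℝ => (x, τ))).intervalIntegrable _ _),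
      hab, sub_self]
  simp_rw [hx]
  rw [intervalIntegral_intervalIntegral_swap]
  · simp [ht]
  · refine IntegrableOn.mono_set ?_
      (Set.prod_mono Set.uIoc_subset_uIcc Set.uIoc_subset_uIcc)
    exact hw'.continuousOn.integrableOn_compact (isCompact_uIcc.prod isCompact_uIcc)

/-- The functions `qx`, `qt`, `qxx`, `qxt` are the indicated continuous partial derivatives of `q`,
and all first-order data are `L`-periodic in the first variable. -/
structure PeriodicPartials (L : ℝ) (q qx qt qxx qxt : ℝ → ℝ → ℝ) : Prop where
  cont : Continuous fun p : ℝ × ℝ => q p.1 p.2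
  cont_x : Continuous fun p : ℝ × ℝ => qx p.1 p.2
  cont_t : Continuous fun p : ℝ × ℝ => qt p.1 p.2
  cont_xx : Continuous fun p : ℝ × ℝ => qxx p.1 p.2
  cont_xt : Continuous fun p : ℝ × ℝ => qxt p.1 p.2
  deriv_x : ∀ x t, HasDerivAt (fun ξ => q ξ t) (qx x t) x
  deriv_t : ∀ x t, HasDerivAt (fun τ => q x τ) (qt x t) t
  deriv_xx : ∀ x t, HasDerivAt (fun ξ => qx ξ t) (qxx x t) x
  deriv_xt : ∀ x t, HasDerivAt (fun τ => qx x τ) (qxt x t) t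
  deriv_tx : ∀ x t, HasDerivAt (fun ξ => qt ξ t) (qxt x t) x
  per : ∀ x t, q (x + L) t = q x t
  per_x : ∀ x t, qx (x + L) t = qx x t
  per_t : ∀ x t, qt (x + L) t = qt x t

theorem ContDiff.exists_periodicPartials {L : ℝ} {q : ℝ → ℝ → ℝ}
    (hq : ContDiff ℝ 2 fun p : ℝ × ℝ => q p.1 p.2) (hper : ∀ x t, q (x + L) t = q x t) :
    ∃ qx qt qxx qxt, PeriodicPartials L q qx qt qxx qxt := by
  have hx1 {g : ℝ × ℝ → ℝ} {g' : ℝ × ℝ →L[ℝ] ℝ} {x t : ℝ} (hg : HasFDerivAt g g' (x, t)) :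
      HasDerivAt (fun ξ => g (ξ, t)) (g' (1, 0)) x :=
    hg.comp_hasDerivAt_of_eq x ((hasDerivAt_id x).prodMk (hasDerivAt_const x t)) rfl
  have ht1 {g : ℝ × ℝ → ℝ} {g' : ℝ × ℝ →L[ℝ] ℝ} {x t : ℝ} (hg : HasFDerivAt g g' (x, t)) :
      HasDerivAt (fun τ => g (x, τ)) (g' (0, 1)) t :=
    hg.comp_hasDerivAt_of_eq t ((hasDerivAt_const t x).prodMk (hasDerivAt_id t)) rfl
  set f : ℝ × ℝ → ℝ := fun p => q p.1 p.2
  have hf1 : ContDiff ℝ 1 (fderiv ℝ f) := hq.fderiv_right (by norm_num)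
  have hf2 : Continuous (fderiv ℝ (fderiv ℝ f)) := hf1.continuous_fderiv (by norm_num)
  have hd (p : ℝ × ℝ) : HasFDerivAt f (fderiv ℝ f p) p :=
    (hq.differentiable (by norm_num) p).hasFDerivAt
  have hdd (p e : ℝ × ℝ) : HasFDerivAt (fun y => fderiv ℝ f y e)
      ((fderiv ℝ (fderiv ℝ f) p).flip e) p :=
    ((hf1.differentiable (by norm_num) p).hasFDerivAt).clm_apply (hasFDerivAt_const e p)
      |>.congr_fderiv (by ext <;> simp)
  have hsymm (p : ℝ × ℝ) (e e' : ℝ × ℝ) :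
      fderiv ℝ (fderiv ℝ f) p e e' = fderiv ℝ (fderiv ℝ f) p e' e :=
    second_derivative_symmetric hd (hf1.differentiable (by norm_num) p).hasFDerivAt e e'
  have dx (x t : ℝ) : HasDerivAt (fun ξ => q ξ t) (fderiv ℝ f (x, t) (1, 0)) x :=
    hx1 (hd (x, t))
  have dt (x t : ℝ) : HasDerivAt (fun τ => q x τ) (fderiv ℝ f (x, t) (0, 1)) t :=
    ht1 (hd (x, t))
  refine ⟨fun x t => fderiv ℝ f (x, t) (1, 0), fun x t => fderiv ℝ f (x, t) (0, 1),
    fun x t => fderiv ℝ (fderiv ℝ f) (x, t) (1, 0) (1, 0),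
    fun x t => fderiv ℝ (fderiv ℝ f) (x, t) (0, 1) (1, 0), ?_⟩
  refine
    { cont := hq.continuous
      cont_x := hf1.continuous.clm_apply continuous_const
      cont_t := hf1.continuous.clm_apply continuous_const
      cont_xx := (hf2.clm_apply continuous_const).clm_apply continuous_const
      cont_xt := (hf2.clm_apply continuous_const).clm_apply continuous_const
      deriv_x := dx
      deriv_t := dt
      deriv_xx := fun x t => hx1 (hdd (x, t) (1, 0))
      deriv_xt := fun x t => ht1 (hdd (x, t) (1, 0))
      deriv_tx := fun x t => ?_
      per := hper
      per_x := fun x t => ?_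
      per_t := fun x t => ?_ }
  · rw [hsymm]
    exact hx1 (hdd (x, t) (0, 1))
  · have h := (dx (x + L) t).comp_add_const x L
    simp only [hper] at h
    exact h.unique (dx x t)
  · have h := dt (x + L) t
    simp only [hper] at h
    exact h.unique (dt x t)

theorem HasDerivAt.complex_of_re_im {f : ℝ → ℂ} {a b : ℝ → ℝ} {a' b' x : ℝ}
    (ha : ∀ y, a y = (f y).re) (hb : ∀ y, b y = (f y).im)
    (hda : HasDerivAt a a' x) (hdb : HasDerivAt b b' x) :
    HasDerivAt f ⟨a', b'⟩ x := by
  have h := hda.ofReal_comp.add (hdb.ofReal_comp.mul_const Complex.I)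
  rw [← Complex.mk_eq_add_mul_I] at h
  exact h.congr_of_eventuallyEq (.of_forall fun y => by simp [ha, hb])

theorem stmt17 (L : ℝ) (hL : 0 < L) (x0 : ℝ) (α β : ℝ) (u v : ℝ → ℝ → ℂ)
    (hu : ContDiff ℝ 2 fun p : ℝ × ℝ => u p.1 p.2)
    (hv : ContDiff ℝ 2 fun p : ℝ × ℝ => v p.1 p.2)
    (hpdeu : ∀ x t,
      Complex.I * deriv (fun τ => u x τ) t
        + Complex.I * (α : ℂ) * deriv (fun ξ => u ξ t) x
        + (1/2) * deriv (fun ξ => deriv (fun ξ' => u ξ' t) ξ) x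
        + (u x t * (starRingEnd ℂ) (u x t) + (β : ℂ) * (v x t * (starRingEnd ℂ) (v x t))) * u x t
        = 0)
    (hpdev : ∀ x t,
      Complex.I * deriv (fun τ => v x τ) t
        - Complex.I * (α : ℂ) * deriv (fun ξ => v ξ t) x
        + (1/2) * deriv (fun ξ => deriv (fun ξ' => v ξ' t) ξ) x
        + ((β : ℂ) * (u x t * (starRingEnd ℂ) (u x t)) + v x t * (starRingEnd ℂ) (v x t)) * v x t
        = 0)
    (q1 q2 q3 q4 p1 p2 p3 p4 S : ℝ → ℝ → ℝ)
    (hq1 : ∀ x t, q1 x t = (u x t).re) (hq2 : ∀ x t, q2 x t = (u x t).im)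
    (hq3 : ∀ x t, q3 x t = (v x t).re) (hq4 : ∀ x t, q4 x t = (v x t).im)
    (hp1 : ∀ x t, p1 x t = (1/2) * deriv (fun ξ => q1 ξ t) x)
    (hp2 : ∀ x t, p2 x t = (1/2) * deriv (fun ξ => q2 ξ t) x)
    (hp3 : ∀ x t, p3 x t = (1/2) * deriv (fun ξ => q3 ξ t) x)
    (hp4 : ∀ x t, p4 x t = (1/2) * deriv (fun ξ => q4 ξ t) x)
    (hS : ∀ x t, S x t = -(1/4) * (q1 x t ^ 2 + q2 x t ^ 2) ^ 2
        - (1/4) * (q3 x t ^ 2 + q4 x t ^ 2) ^ 2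
        - (1/2) * β * (q1 x t ^ 2 + q2 x t ^ 2) * (q3 x t ^ 2 + q4 x t ^ 2)
        - (p1 x t ^ 2 + p2 x t ^ 2 + p3 x t ^ 2 + p4 x t ^ 2))
    (hup : ∀ x t, u (x + L) t = u x t) (hvp : ∀ x t, v (x + L) t = v x t)
    (E I : ℝ → ℝ → ℝ) (hE : ∀ x t, E x t = S x t
        - α * (q2 x t * p1 x t - q1 x t * p2 x t + q3 x t * p4 x t - q4 x t * p3 x t)
        - (1/2) * ((q1 x t * deriv (fun ξ => p1 ξ t) x - 2 * p1 x t ^ 2)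
          + (q2 x t * deriv (fun ξ => p2 ξ t) x - 2 * p2 x t ^ 2)
          + (q3 x t * deriv (fun ξ => p3 ξ t) x - 2 * p3 x t ^ 2)
          + (q4 x t * deriv (fun ξ => p4 ξ t) x - 2 * p4 x t ^ 2)))
    (hI : ∀ x t, I x t = q2 x t * p1 x t - q1 x t * p2 x t
        + q4 x t * p3 x t - q3 x t * p4 x t) :
    ∀ t, (∫ x in x0..(x0 + L), E x t) = (∫ x in x0..(x0 + L), E x 0)
      ∧ (∫ x in x0..(x0 + L), I x t) = (∫ x in x0..(x0 + L), I x 0) := by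
  have hq (w : ℝ → ℝ → ℂ) (hw : ContDiff ℝ 2 fun p : ℝ × ℝ => w p.1 p.2)
      (hper : ∀ x t, w (x + L) t = w x t) (a b : ℝ → ℝ → ℝ)
      (ha : ∀ x t, a x t = (w x t).re) (hb : ∀ x t, b x t = (w x t).im) :
      (∃ ax at' axx axt, PeriodicPartials L a ax at' axx axt) ∧
      ∃ bx bt bxx bxt, PeriodicPartials L b bx bt bxx bxt := by
    constructor
    · refine ContDiff.exists_periodicPartials ?_ (by simp [ha, hper])
      simp only [ha]
      exact Complex.reCLM.contDiff.comp hw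
    · refine ContDiff.exists_periodicPartials ?_ (by simp [hb, hper])
      simp only [hb]
      exact Complex.imCLM.contDiff.comp hw
  obtain ⟨⟨q1x, q1t, q1xx, q1xt, h1⟩, q2x, q2t, q2xx, q2xt, h2⟩ := hq u hu hup q1 q2 hq1 hq2
  obtain ⟨⟨q3x, q3t, q3xx, q3xt, h3⟩, q4x, q4t, q4xx, q4xt, h4⟩ := hq v hv hvp q3 q4 hq3 hq4
  have hux (x t : ℝ) : deriv (fun ξ => u ξ t) x = ⟨q1x x t, q2x x t⟩ :=
    (HasDerivAt.complex_of_re_im (fun y => hq1 y t) (fun y => hq2 y t)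
      (h1.deriv_x x t) (h2.deriv_x x t)).deriv
  have hut (x t : ℝ) : deriv (fun τ => u x τ) t = ⟨q1t x t, q2t x t⟩ :=
    (HasDerivAt.complex_of_re_im (fun y => hq1 x y) (fun y => hq2 x y)
      (h1.deriv_t x t) (h2.deriv_t x t)).deriv
  have huxx (x t : ℝ) : deriv (fun ξ => (⟨q1x ξ t, q2x ξ t⟩ : ℂ)) x = ⟨q1xx x t, q2xx x t⟩ :=
    (HasDerivAt.complex_of_re_im (fun _ => rfl) (fun _ => rfl)
      (h1.deriv_xx x t) (h2.deriv_xx x t)).deriv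
  have hvx (x t : ℝ) : deriv (fun ξ => v ξ t) x = ⟨q3x x t, q4x x t⟩ :=
    (HasDerivAt.complex_of_re_im (fun y => hq3 y t) (fun y => hq4 y t)
      (h3.deriv_x x t) (h4.deriv_x x t)).deriv
  have hvt (x t : ℝ) : deriv (fun τ => v x τ) t = ⟨q3t x t, q4t x t⟩ :=
    (HasDerivAt.complex_of_re_im (fun y => hq3 x y) (fun y => hq4 x y)
      (h3.deriv_t x t) (h4.deriv_t x t)).deriv
  have hvxx (x t : ℝ) : deriv (fun ξ => (⟨q3x ξ t, q4x ξ t⟩ : ℂ)) x = ⟨q3xx x t, q4xx x t⟩ :=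
    (HasDerivAt.complex_of_re_im (fun _ => rfl) (fun _ => rfl)
      (h3.deriv_xx x t) (h4.deriv_xx x t)).deriv
  have hu' (x t : ℝ) : u x t = ⟨q1 x t, q2 x t⟩ := by rw [hq1, hq2]
  have hv' (x t : ℝ) : v x t = ⟨q3 x t, q4 x t⟩ := by rw [hq3, hq4]
  simp only [hux, huxx, hut, hvx, hvxx, hvt] at hpdeu hpdev
  simp only [hu', hv'] at hpdeu hpdev
  have e1 (x t : ℝ) : q1t x t = -α * q1x x t - 1 / 2 * q2xx x t
      - (q1 x t ^ 2 + q2 x t ^ 2 + β * (q3 x t ^ 2 + q4 x t ^ 2)) * q2 x t := by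
    have h := congrArg Complex.im (hpdeu x t)
    norm_num at h
    linear_combination h
  have e2 (x t : ℝ) : q2t x t = -α * q2x x t + 1 / 2 * q1xx x t
      + (q1 x t ^ 2 + q2 x t ^ 2 + β * (q3 x t ^ 2 + q4 x t ^ 2)) * q1 x t := by
    have h := congrArg Complex.re (hpdeu x t)
    norm_num at h
    linear_combination -h
  have e3 (x t : ℝ) : q3t x t = α * q3x x t - 1 / 2 * q4xx x t
      - (β * (q1 x t ^ 2 + q2 x t ^ 2) + (q3 x t ^ 2 + q4 x t ^ 2)) * q4 x t := by
    have h := congrArg Complex.im (hpdev x t)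
    norm_num at h
    linear_combination h
  have e4 (x t : ℝ) : q4t x t = α * q4x x t + 1 / 2 * q3xx x t
      + (β * (q1 x t ^ 2 + q2 x t ^ 2) + (q3 x t ^ 2 + q4 x t ^ 2)) * q3 x t := by
    have h := congrArg Complex.re (hpdev x t)
    norm_num at h
    linear_combination -h
  simp only [(h1.deriv_x _ _).deriv] at hp1
  simp only [(h2.deriv_x _ _).deriv] at hp2
  simp only [(h3.deriv_x _ _).deriv] at hp3
  simp only [(h4.deriv_x _ _).deriv] at hp4
  simp only [hS, hp1, hp2, hp3, hp4, ((h1.deriv_xx _ _).const_mul (1 / 2 : ℝ)).deriv,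
    ((h2.deriv_xx _ _).const_mul (1 / 2 : ℝ)).deriv,
    ((h3.deriv_xx _ _).const_mul (1 / 2 : ℝ)).deriv,
    ((h4.deriv_xx _ _).const_mul (1 / 2 : ℝ)).deriv] at hE hI
  clear hpdeu hpdev hS hp1 hp2 hp3 hp4 hux hut huxx hvx hvt hvxx hu' hv' hq
  have c1 := h1.cont
  have c2 := h2.cont
  have c3 := h3.cont
  have c4 := h4.cont
  have c1x := h1.cont_x
  have c2x := h2.cont_x
  have c3x := h3.cont_x
  have c4x := h4.cont_x
  have c1t := h1.cont_t
  have c2t := h2.cont_t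
  have c3t := h3.cont_t
  have c4t := h4.cont_t
  have c1xx := h1.cont_xx
  have c2xx := h2.cont_xx
  have c3xx := h3.cont_xx
  have c4xx := h4.cont_xx
  have c1xt := h1.cont_xt
  have c2xt := h2.cont_xt
  have c3xt := h3.cont_xt
  have c4xt := h4.cont_xt
  have slice {g : ℝ → ℝ → ℝ} (hg : Continuous fun p : ℝ × ℝ => g p.1 p.2) (t : ℝ) :
      Continuous fun x => g x t := hg.comp (by fun_prop : Continuous fun x : ℝ => (x, t))
  let W : ℝ → ℝ → ℝ := fun x t => -(1 / 4) * (q1 x t ^ 2 + q2 x t ^ 2) ^ 2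
    - 1 / 4 * (q3 x t ^ 2 + q4 x t ^ 2) ^ 2
    - 1 / 2 * β * (q1 x t ^ 2 + q2 x t ^ 2) * (q3 x t ^ 2 + q4 x t ^ 2)
    + 1 / 4 * (q1x x t ^ 2 + q2x x t ^ 2 + q3x x t ^ 2 + q4x x t ^ 2)
    + α / 2 * (q1 x t * q2x x t - q2 x t * q1x x t - q3 x t * q4x x t + q4 x t * q3x x t)
  have hWc : Continuous fun p : ℝ × ℝ => W p.1 p.2 := by
    simp only [W]
    fun_prop
  have hEW (t : ℝ) : ∫ x in x0..(x0 + L), E x t = ∫ x in x0..(x0 + L), W x t := by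
    have hEc : Continuous fun p : ℝ × ℝ => E p.1 p.2 := by
      simp only [hE]
      fun_prop
    rw [← sub_eq_zero, ← intervalIntegral.integral_sub
      ((slice hEc t).intervalIntegrable _ _) ((slice hWc t).intervalIntegrable _ _)]
    rw [intervalIntegral.integral_eq_sub_of_hasDerivAt (f := fun x => -(1 / 4) *
      (q1 x t * q1x x t + q2 x t * q2x x t + q3 x t * q3x x t + q4 x t * q4x x t))]
    · simp only [h1.per, h1.per_x, h2.per, h2.per_x, h3.per, h3.per_x, h4.per, h4.per_x, sub_self]
    · intro x _
      convert! (((((h1.deriv_x x t).mul (h1.deriv_xx x t)).add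
        ((h2.deriv_x x t).mul (h2.deriv_xx x t))).add
        ((h3.deriv_x x t).mul (h3.deriv_xx x t))).add
        ((h4.deriv_x x t).mul (h4.deriv_xx x t))).const_mul (-(1 / 4) : ℝ) using 1
      simp only [hE, W]
      ring
    · exact ((slice hEc t).sub (slice hWc t)).intervalIntegrable _ _
  have hIc : Continuous fun p : ℝ × ℝ => I p.1 p.2 := by
    simp only [hI]
    fun_prop
  intro t
  constructor
  · rw [hEW, hEW]
    refine integral_eq_of_conservation_law
      (w' := fun x t => 1 / 2 * (q1xx x t * q1t x t + q1x x t * q1xt x t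
        + q2xx x t * q2t x t + q2x x t * q2xt x t + q3xx x t * q3t x t + q3x x t * q3xt x t
        + q4xx x t * q4t x t + q4x x t * q4xt x t)
        + α / 2 * (q1x x t * q2t x t + q1 x t * q2xt x t - (q2x x t * q1t x t + q2 x t * q1xt x t)
        - (q3x x t * q4t x t + q3 x t * q4xt x t) + (q4x x t * q3t x t + q4 x t * q3xt x t)))
      (f := fun x t => 1 / 2 * (q1x x t * q1t x t + q2x x t * q2t x t + q3x x t * q3t x t
        + q4x x t * q4t x t) + α / 2 * (q1 x t * q2t x t - q2 x t * q1t x t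
        - q3 x t * q4t x t + q4 x t * q3t x t))
      (by fun_prop) (fun x t => ?_) (fun x t => ?_) (fun t => ?_) (slice hWc) 0 t
    · have d1 := h1.deriv_t x t
      have d2 := h2.deriv_t x t
      have d3 := h3.deriv_t x t
      have d4 := h4.deriv_t x t
      have d1x := h1.deriv_xt x t
      have d2x := h2.deriv_xt x t
      have d3x := h3.deriv_xt x t
      have d4x := h4.deriv_xt x t
      have n1 := (d1.fun_pow 2).fun_add (d2.fun_pow 2)
      have n2 := (d3.fun_pow 2).fun_add (d4.fun_pow 2)
      convert! (((((n1.fun_pow 2).const_mul (-(1 / 4) : ℝ)).fun_sub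
        ((n2.fun_pow 2).const_mul (1 / 4 : ℝ))).fun_sub
        ((n1.const_mul (1 / 2 * β)).fun_mul n2)).fun_add
        (((((d1x.fun_pow 2).fun_add (d2x.fun_pow 2)).fun_add (d3x.fun_pow 2)).fun_add
          (d4x.fun_pow 2)).const_mul (1 / 4 : ℝ))).fun_add
        (((((d1.fun_mul d2x).fun_sub (d2.fun_mul d1x)).fun_sub (d3.fun_mul d4x)).fun_add
          (d4.fun_mul d3x)).const_mul (α / 2)) using 1
      simp only [e1, e2, e3, e4]
      push_cast
      ring
    · have d1 := h1.deriv_x x t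
      have d2 := h2.deriv_x x t
      have d3 := h3.deriv_x x t
      have d4 := h4.deriv_x x t
      have d1t := h1.deriv_tx x t
      have d2t := h2.deriv_tx x t
      have d3t := h3.deriv_tx x t
      have d4t := h4.deriv_tx x t
      convert! (((((h1.deriv_xx x t).fun_mul d1t).fun_add ((h2.deriv_xx x t).fun_mul d2t)).fun_add
        ((h3.deriv_xx x t).fun_mul d3t)).fun_add
        ((h4.deriv_xx x t).fun_mul d4t)).const_mul (1 / 2 : ℝ) |>.fun_add
        (((((d1.fun_mul d2t).fun_sub (d2.fun_mul d1t)).fun_sub (d3.fun_mul d4t)).fun_add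
          (d4.fun_mul d3t)).const_mul (α / 2)) using 1
      ring
    · simp only [h1.per, h2.per, h3.per, h4.per, h1.per_x, h2.per_x, h3.per_x, h4.per_x,
        h1.per_t, h2.per_t, h3.per_t, h4.per_t]
  · refine integral_eq_of_conservation_law
      (w' := fun x t => 1 / 2 * (q2t x t * q1x x t + q2 x t * q1xt x t
        - (q1t x t * q2x x t + q1 x t * q2xt x t) + (q4t x t * q3x x t + q4 x t * q3xt x t)
        - (q3t x t * q4x x t + q3 x t * q4xt x t)))
      (f := fun x t => 1 / 2 * (q2 x t * q1t x t - q1 x t * q2t x t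
        + q4 x t * q3t x t - q3 x t * q4t x t)
        + 1 / 4 * (q1x x t ^ 2 + q2x x t ^ 2 + q3x x t ^ 2 + q4x x t ^ 2)
        + (1 / 4 * (q1 x t ^ 2 + q2 x t ^ 2) ^ 2 + 1 / 4 * (q3 x t ^ 2 + q4 x t ^ 2) ^ 2
        + 1 / 2 * β * (q1 x t ^ 2 + q2 x t ^ 2) * (q3 x t ^ 2 + q4 x t ^ 2)))
      (by fun_prop) (fun x t => ?_) (fun x t => ?_) (fun t => ?_) (slice hIc) 0 t
    · simp only [hI]
      convert! (((((h2.deriv_t x t).fun_mul ((h1.deriv_xt x t).const_mul (1 / 2 : ℝ))).fun_sub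
        ((h1.deriv_t x t).fun_mul ((h2.deriv_xt x t).const_mul (1 / 2 : ℝ)))).fun_add
        ((h4.deriv_t x t).fun_mul ((h3.deriv_xt x t).const_mul (1 / 2 : ℝ)))).fun_sub
        ((h3.deriv_t x t).fun_mul ((h4.deriv_xt x t).const_mul (1 / 2 : ℝ)))) using 1
      ring
    · have d1 := h1.deriv_x x t
      have d2 := h2.deriv_x x t
      have d3 := h3.deriv_x x t
      have d4 := h4.deriv_x x t
      have d1t := h1.deriv_tx x t
      have d2t := h2.deriv_tx x t
      have d3t := h3.deriv_tx x t
      have d4t := h4.deriv_tx x t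
      have d1x := h1.deriv_xx x t
      have d2x := h2.deriv_xx x t
      have d3x := h3.deriv_xx x t
      have d4x := h4.deriv_xx x t
      have n1 := (d1.fun_pow 2).fun_add (d2.fun_pow 2)
      have n2 := (d3.fun_pow 2).fun_add (d4.fun_pow 2)
      convert! (((((d2.fun_mul d1t).fun_sub (d1.fun_mul d2t)).fun_add (d4.fun_mul d3t)).fun_sub
        (d3.fun_mul d4t)).const_mul (1 / 2 : ℝ)).fun_add
        (((((d1x.fun_pow 2).fun_add (d2x.fun_pow 2)).fun_add (d3x.fun_pow 2)).fun_add
          (d4x.fun_pow 2)).const_mul (1 / 4 : ℝ)) |>.fun_add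
        ((((n1.fun_pow 2).const_mul (1 / 4 : ℝ)).fun_add
        ((n2.fun_pow 2).const_mul (1 / 4 : ℝ))).fun_add
        ((n1.const_mul (1 / 2 * β)).fun_mul n2)) using 1
      simp only [e1, e2, e3, e4]
      push_cast
      ring
    · simp only [h1.per, h2.per, h3.per, h4.per, h1.per_x, h2.per_x, h3.per_x, h4.per_x,
        h1.per_t, h2.per_t, h3.per_t, h4.per_t]
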